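/- arXiv:1912.03684 — 2 statements merged into one kernel-verified Lean document; each statement's English description precedes it below -/
import Mathlib

section
/- Let $H \in (0,1)$, $\kappa > 0$, $t \ge 0$, $\varepsilon > 0$, and set $c_{1,H} = \frac{1}{2\pi}\Gamma(2H+1)\sin(H\pi)$. Then $c_{1,H}\Big[\int_0^{t} \int_{\mathbb{R}} e^{-\kappa s \xi^2}\big(1-e^{-\kappa \varepsilon \xi^2/2}\big)^2 |\xi|^{1-2H}\, d\xi\, ds \;+\; \Gamma(1-H) H^{-1} \kappa^{H-1} \varepsilon^{H} \;+\; \kappa^{-1}\int_{\mathbb{R}} e^{-\kappa t \xi^2}\big(1-e^{-\kappa \varepsilon \xi^2/2}\big)^2 |\xi|^{-1-2H}\, d\xi\Big] = \frac{2^{1-H}\Gamma(2H)}{\kappa^{1-H}\Gamma(H)}\, \varepsilon^{H}$. -/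
open MeasureTheory Real

lemma integrableOn_one_sub_exp_neg_mul_sq_mul_rpow {H b : ℝ} (hH : H ∈ Set.Ioo (0 : ℝ) 1)
    (hb : 0 ≤ b) :
    IntegrableOn (fun x : ℝ => (1 - exp (-b * x ^ 2)) * x ^ (-1 - 2 * H)) (Set.Ioi 0) := by
  obtain ⟨hH0, hH1⟩ := hH
  have hmeas : Measurable (fun x : ℝ => (1 - exp (-b * x ^ 2)) * x ^ (-1 - 2 * H)) := by
    fun_prop
  have hlow : ∀ x : ℝ, 0 ≤ 1 - exp (-b * x ^ 2) := fun x => by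
    have : exp (-b * x ^ 2) ≤ 1 := exp_le_one_iff.2 (by nlinarith [mul_nonneg hb (sq_nonneg x)])
    linarith
  rw [← Set.Ioc_union_Ioi_eq_Ioi (zero_le_one' ℝ)]
  refine IntegrableOn.union ?_ ?_
  · have hint : IntegrableOn (fun x : ℝ => b * x ^ (1 - 2 * H)) (Set.Ioc 0 1) := by
      have h := (intervalIntegral.intervalIntegrable_rpow' (a := 0) (b := 1)
        (r := 1 - 2 * H) (by linarith)).const_mul b
      rwa [intervalIntegrable_iff_integrableOn_Ioc_of_le zero_le_one] at h
    refine hint.mono' hmeas.aestronglyMeasurable ?_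
    refine (ae_restrict_mem measurableSet_Ioc).mono fun x hx => ?_
    have hx0 : 0 < x := hx.1
    rw [norm_of_nonneg (mul_nonneg (hlow x) (rpow_nonneg hx0.le _))]
    have hpow : x ^ (1 - 2 * H) = x ^ 2 * x ^ (-1 - 2 * H) := by
      rw [← rpow_two, ← rpow_add hx0]; congr 1; ring
    rw [hpow, ← mul_assoc]
    refine mul_le_mul_of_nonneg_right ?_ (rpow_nonneg hx0.le _)
    linarith [add_one_le_exp (-b * x ^ 2)]
  · refine (integrableOn_Ioi_rpow_of_lt (a := -1 - 2 * H) (by linarith) one_pos).mono'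
      hmeas.aestronglyMeasurable ?_
    refine (ae_restrict_mem measurableSet_Ioi).mono fun x hx => ?_
    have hx0 : 0 < x := one_pos.trans hx
    rw [norm_of_nonneg (mul_nonneg (hlow x) (rpow_nonneg hx0.le _))]
    refine mul_le_of_le_one_left (rpow_nonneg hx0.le _) ?_
    linarith [exp_pos (-b * x ^ 2)]

lemma integral_rpow_mul_exp_neg_mul_sq {H b : ℝ} (hH : H < 1) (hb : 0 < b) :
    ∫ x in Set.Ioi (0 : ℝ), x ^ (1 - 2 * H) * exp (-b * x ^ 2) =
      b ^ (H - 1) * Gamma (1 - H) / 2 := by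
  have h := integral_rpow_mul_exp_neg_mul_rpow (p := 2) (q := 1 - 2 * H) two_pos
    (by linarith) hb
  simp_rw [rpow_two] at h
  rw [h, show -(1 - 2 * H + 1) / 2 = H - 1 by ring, show (1 - 2 * H + 1) / 2 = 1 - H by ring]
  ring

lemma integral_one_sub_exp_neg_mul_sq_mul_rpow {H b : ℝ} (hH : H ∈ Set.Ioo (0 : ℝ) 1)
    (hb : 0 ≤ b) :
    ∫ x in Set.Ioi (0 : ℝ), (1 - exp (-b * x ^ 2)) * x ^ (-1 - 2 * H) =
      b ^ H * Gamma (1 - H) / (2 * H) := by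
  have hint := integrableOn_one_sub_exp_neg_mul_sq_mul_rpow hH hb
  obtain ⟨hH0, hH1⟩ := hH
  rcases hb.eq_or_lt with rfl | hb
  · simp [zero_rpow hH0.ne']
  have hdu : ∀ x ∈ Set.Ioi (0 : ℝ), HasDerivAt (fun x : ℝ => 1 - exp (-b * x ^ 2))
      (2 * b * x * exp (-b * x ^ 2)) x := fun x _ => by
    have h := ((((hasDerivAt_id x).pow 2).const_mul (-b)).exp).const_sub 1
    refine h.congr_deriv ?_
    simp only [id_eq, Pi.pow_apply]
    ring
  have hdv : ∀ x ∈ Set.Ioi (0 : ℝ), HasDerivAt (fun x : ℝ => -(2 * H)⁻¹ * x ^ (-(2 * H)))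
      (x ^ (-1 - 2 * H)) x := fun x hx => by
    have h := (hasDerivAt_rpow_const (p := -(2 * H)) (Or.inl (ne_of_gt hx))).const_mul
      (-(2 * H)⁻¹)
    refine h.congr_deriv ?_
    rw [show -(2 * H) - 1 = -1 - 2 * H by ring]
    field_simp
  have hprod : ∀ x ∈ Set.Ioi (0 : ℝ),
      2 * b * x * exp (-b * x ^ 2) * (-(2 * H)⁻¹ * x ^ (-(2 * H))) =
        -(b / H) * (x ^ (1 - 2 * H) * exp (-b * x ^ 2)) := fun x hx => by
    rw [show 1 - 2 * H = 1 + -(2 * H) by ring, rpow_add hx, rpow_one]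
    field_simp
  have hint' : IntegrableOn (fun x : ℝ =>
      2 * b * x * exp (-b * x ^ 2) * (-(2 * H)⁻¹ * x ^ (-(2 * H)))) (Set.Ioi 0) :=
    IntegrableOn.congr_fun ((integrableOn_rpow_mul_exp_neg_mul_sq hb
      (s := 1 - 2 * H) (by linarith)).const_mul (-(b / H)))
      (fun x hx => (hprod x hx).symm) measurableSet_Ioi
  have hbound : ∀ x ∈ Set.Ioi (0 : ℝ),
      ‖((fun x : ℝ => 1 - exp (-b * x ^ 2)) * fun x : ℝ => -(2 * H)⁻¹ * x ^ (-(2 * H))) x‖ =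
        (2 * H)⁻¹ * ((1 - exp (-b * x ^ 2)) * x ^ (-(2 * H))) := fun x hx => by
    have h1 : exp (-b * x ^ 2) ≤ 1 :=
      exp_le_one_iff.2 (by nlinarith [mul_nonneg hb.le (sq_nonneg x)])
    have h2 : 0 ≤ (2 * H)⁻¹ * ((1 - exp (-b * x ^ 2)) * x ^ (-(2 * H))) :=
      mul_nonneg (by positivity) (mul_nonneg (by linarith) (rpow_nonneg (le_of_lt hx) _))
    rw [← abs_of_nonneg h2, ← abs_neg, norm_eq_abs, Pi.mul_apply]
    congr 1; ring
  have hzero : Filter.Tendsto ((fun x : ℝ => 1 - exp (-b * x ^ 2)) *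
      fun x : ℝ => -(2 * H)⁻¹ * x ^ (-(2 * H))) (nhdsWithin 0 (Set.Ioi 0)) (nhds 0) := by
    have hlim : Filter.Tendsto (fun x : ℝ => (2 * H)⁻¹ * (b * x ^ (2 - 2 * H)))
        (nhdsWithin 0 (Set.Ioi 0)) (nhds 0) := by
      have h : ContinuousAt (fun x : ℝ => (2 * H)⁻¹ * (b * x ^ (2 - 2 * H))) 0 := by
        have := continuousAt_rpow_const (0 : ℝ) (2 - 2 * H) (Or.inr (by linarith))
        fun_prop
      have h' := h.tendsto
      rw [zero_rpow (by linarith), mul_zero, mul_zero] at h'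
      exact h'.mono_left nhdsWithin_le_nhds
    refine squeeze_zero_norm' ?_ hlim
    filter_upwards [self_mem_nhdsWithin] with x hx
    rw [hbound x hx, show 2 - 2 * H = 2 + -(2 * H) by ring, rpow_add hx, rpow_two, ← mul_assoc b]
    have := rpow_nonneg (le_of_lt hx) (-(2 * H))
    have := add_one_le_exp (-b * x ^ 2)
    gcongr
    linarith
  have hinfty : Filter.Tendsto ((fun x : ℝ => 1 - exp (-b * x ^ 2)) *
      fun x : ℝ => -(2 * H)⁻¹ * x ^ (-(2 * H))) Filter.atTop (nhds 0) := by
    have hlim := (tendsto_rpow_neg_atTop (y := 2 * H) (by positivity)).const_mul (2 * H)⁻¹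
    rw [mul_zero] at hlim
    refine squeeze_zero_norm' ?_ hlim
    filter_upwards [Filter.eventually_gt_atTop 0] with x hx
    rw [hbound x hx]
    have := rpow_nonneg hx.le (-(2 * H))
    gcongr
    exact mul_le_of_le_one_left this (by linarith [exp_pos (-b * x ^ 2)])
  rw [integral_Ioi_mul_deriv_eq_deriv_mul hdu hdv hint hint' hzero hinfty,
    setIntegral_congr_fun measurableSet_Ioi hprod, integral_const_mul,
    integral_rpow_mul_exp_neg_mul_sq hH1 hb, rpow_sub_one hb.ne']
  field_simp
  ring

lemma exp_mul_one_sub_exp_sq (κ s ε x : ℝ) :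
    exp (-κ * s * x ^ 2) * (1 - exp (-κ * ε * x ^ 2 / 2)) ^ 2 =
      exp (-(κ * s) * x ^ 2) - 2 * exp (-(κ * (s + ε / 2)) * x ^ 2) +
        exp (-(κ * (s + ε)) * x ^ 2) := by
  have h1 : exp (-(κ * (s + ε / 2)) * x ^ 2) =
      exp (-κ * s * x ^ 2) * exp (-κ * ε * x ^ 2 / 2) := by
    rw [← exp_add]; congr 1; ring
  have h2 : exp (-(κ * (s + ε)) * x ^ 2) =
      exp (-κ * s * x ^ 2) * exp (-κ * ε * x ^ 2 / 2) ^ 2 := by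
    rw [← exp_nat_mul, ← exp_add]; congr 1; push_cast; ring
  rw [h1, h2, ← neg_mul]
  ring

lemma integral_exp_mul_one_sub_exp_sq_mul_abs_rpow {H κ s ε : ℝ} (hH : H < 1)
    (hκ : 0 < κ) (hs : 0 < s) (hε : 0 < ε) :
    ∫ ξ : ℝ, exp (-κ * s * ξ ^ 2) * (1 - exp (-κ * ε * ξ ^ 2 / 2)) ^ 2 * |ξ| ^ (1 - 2 * H) =
      κ ^ (H - 1) * Gamma (1 - H) *
        (s ^ (H - 1) - 2 * (s + ε / 2) ^ (H - 1) + (s + ε) ^ (H - 1)) := by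
  have hint : ∀ b : ℝ, 0 < b →
      IntegrableOn (fun x : ℝ => x ^ (1 - 2 * H) * exp (-b * x ^ 2)) (Set.Ioi 0) :=
    fun b hb => integrableOn_rpow_mul_exp_neg_mul_sq hb (by linarith)
  have h0 : 0 < κ * s := by positivity
  have h1 : 0 < κ * (s + ε / 2) := by positivity
  have h2 : 0 < κ * (s + ε) := by positivity
  have habs := integral_comp_abs (f := fun x : ℝ =>
    exp (-κ * s * x ^ 2) * (1 - exp (-κ * ε * x ^ 2 / 2)) ^ 2 * x ^ (1 - 2 * H))
  simp only [sq_abs] at habs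
  have hexp : ∀ x : ℝ,
      exp (-κ * s * x ^ 2) * (1 - exp (-κ * ε * x ^ 2 / 2)) ^ 2 * x ^ (1 - 2 * H) =
        x ^ (1 - 2 * H) * exp (-(κ * s) * x ^ 2) -
          2 * (x ^ (1 - 2 * H) * exp (-(κ * (s + ε / 2)) * x ^ 2)) +
          x ^ (1 - 2 * H) * exp (-(κ * (s + ε)) * x ^ 2) := fun x => by
    rw [exp_mul_one_sub_exp_sq]; ring
  rw [habs]
  simp_rw [hexp]
  rw [integral_add ((hint _ h0).fun_sub ((hint _ h1).const_mul 2)) (hint _ h2),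
    integral_sub (hint _ h0) ((hint _ h1).const_mul 2), integral_const_mul,
    integral_rpow_mul_exp_neg_mul_sq hH h0, integral_rpow_mul_exp_neg_mul_sq hH h1,
    integral_rpow_mul_exp_neg_mul_sq hH h2, mul_rpow hκ.le hs.le,
    mul_rpow hκ.le (by positivity), mul_rpow hκ.le (by positivity)]
  ring

lemma integral_exp_mul_one_sub_exp_sq_mul_abs_rpow_neg {H κ t ε : ℝ}
    (hH : H ∈ Set.Ioo (0 : ℝ) 1) (hκ : 0 < κ) (ht : 0 ≤ t) (hε : 0 < ε) :
    ∫ ξ : ℝ, exp (-κ * t * ξ ^ 2) * (1 - exp (-κ * ε * ξ ^ 2 / 2)) ^ 2 * |ξ| ^ (-1 - 2 * H) =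
      κ ^ H * Gamma (1 - H) / H *
        (2 * (t + ε / 2) ^ H - t ^ H - (t + ε) ^ H) := by
  have hint := fun (b : ℝ) (hb : 0 ≤ b) => integrableOn_one_sub_exp_neg_mul_sq_mul_rpow hH hb
  have h0 : 0 ≤ κ * t := by positivity
  have h1 : 0 ≤ κ * (t + ε / 2) := by positivity
  have h2 : 0 ≤ κ * (t + ε) := by positivity
  have habs := integral_comp_abs (f := fun x : ℝ =>
    exp (-κ * t * x ^ 2) * (1 - exp (-κ * ε * x ^ 2 / 2)) ^ 2 * x ^ (-1 - 2 * H))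
  simp only [sq_abs] at habs
  have hexp : ∀ x : ℝ,
      exp (-κ * t * x ^ 2) * (1 - exp (-κ * ε * x ^ 2 / 2)) ^ 2 * x ^ (-1 - 2 * H) =
        2 * ((1 - exp (-(κ * (t + ε / 2)) * x ^ 2)) * x ^ (-1 - 2 * H)) -
          (1 - exp (-(κ * t) * x ^ 2)) * x ^ (-1 - 2 * H) -
          (1 - exp (-(κ * (t + ε)) * x ^ 2)) * x ^ (-1 - 2 * H) := fun x => by
    rw [exp_mul_one_sub_exp_sq]; ring
  rw [habs]
  simp_rw [hexp]
  rw [integral_sub (IntegrableOn.fun_sub ((hint _ h1).const_mul 2) (hint _ h0)) (hint _ h2),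
    integral_sub ((hint _ h1).const_mul 2) (hint _ h0), integral_const_mul,
    integral_one_sub_exp_neg_mul_sq_mul_rpow hH h0,
    integral_one_sub_exp_neg_mul_sq_mul_rpow hH h1,
    integral_one_sub_exp_neg_mul_sq_mul_rpow hH h2, mul_rpow hκ.le ht,
    mul_rpow hκ.le (by positivity), mul_rpow hκ.le (by positivity)]
  have := hH.1.ne'
  field_simp

lemma setIntegral_rpow_second_difference {H t ε : ℝ} (hH : 0 < H) (ht : 0 ≤ t) :
    ∫ s in Set.Ioo (0 : ℝ) t,
        (s ^ (H - 1) - 2 * (s + ε / 2) ^ (H - 1) + (s + ε) ^ (H - 1)) =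
      (t ^ H - 2 * ((t + ε / 2) ^ H - (ε / 2) ^ H) + ((t + ε) ^ H - ε ^ H)) / H := by
  have hr : -1 < H - 1 := by linarith
  have hint : ∀ d : ℝ, IntervalIntegrable (fun s : ℝ => (s + d) ^ (H - 1)) volume 0 t := fun d => by
    simpa using (intervalIntegral.intervalIntegrable_rpow' (a := 0 + d) (b := t + d)
      hr).comp_add_right d
  have hval : ∀ d : ℝ, ∫ s in (0 : ℝ)..t, (s + d) ^ (H - 1) = ((t + d) ^ H - d ^ H) / H :=
    fun d => by
      rw [intervalIntegral.integral_comp_add_right (fun x : ℝ => x ^ (H - 1)),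
        integral_rpow (Or.inl hr), zero_add, sub_add_cancel]
  have hi0 := intervalIntegral.intervalIntegrable_rpow' (a := 0) (b := t) hr
  rw [← integral_Ioc_eq_integral_Ioo, ← intervalIntegral.integral_of_le ht,
    intervalIntegral.integral_add (hi0.sub ((hint _).const_mul 2)) (hint _),
    intervalIntegral.integral_sub hi0 ((hint _).const_mul 2),
    intervalIntegral.integral_const_mul, hval, hval, integral_rpow (Or.inl hr),
    sub_add_cancel, zero_rpow hH.ne']
  ring

theorem temporal_increment_variance (H κ t ε : ℝ) (hH : H ∈ Set.Ioo (0:ℝ) 1)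
    (hκ : 0 < κ) (ht : 0 ≤ t) (hε : 0 < ε) :
    (Real.Gamma (2*H + 1) * Real.sin (H * π) / (2 * π)) *
      ((∫ s in Set.Ioo (0:ℝ) t, ∫ ξ : ℝ,
          Real.exp (-κ * s * ξ^2) * (1 - Real.exp (-κ * ε * ξ^2 / 2))^2 * |ξ| ^ (1 - 2*H)) +
        Real.Gamma (1 - H) * H⁻¹ * κ ^ (H - 1) * ε ^ H +
        κ⁻¹ * ∫ ξ : ℝ, Real.exp (-κ * t * ξ^2) *
          (1 - Real.exp (-κ * ε * ξ^2 / 2))^2 * |ξ| ^ (-1 - 2*H)) =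
      (2:ℝ) ^ (1 - H) * Real.Gamma (2*H) / (κ ^ (1 - H) * Real.Gamma H) * ε ^ H := by
  have hH0 : 0 < H := hH.1
  have hH1 : H < 1 := hH.2
  rw [setIntegral_congr_fun measurableSet_Ioo (fun s hs =>
      integral_exp_mul_one_sub_exp_sq_mul_abs_rpow hH1 hκ hs.1 hε), integral_const_mul,
    setIntegral_rpow_second_difference hH0 ht,
    integral_exp_mul_one_sub_exp_sq_mul_abs_rpow_neg hH hκ ht hε,
    Gamma_add_one (by positivity), rpow_sub_one hκ.ne', div_rpow hε.le two_pos.le,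
    rpow_sub two_pos, rpow_sub hκ, rpow_one, rpow_one]
  have hΓ := Gamma_mul_Gamma_one_sub H
  have hsin : 0 < sin (π * H) := sin_pos_of_pos_of_lt_pi (by positivity)
    (by nlinarith [pi_pos])
  have hΓH : 0 < Gamma H := Gamma_pos_of_pos hH0
  have hΓ' : Gamma (1 - H) = π / (sin (π * H) * Gamma H) := by
    rw [eq_div_iff (by positivity)]
    rw [eq_div_iff hsin.ne'] at hΓ
    linarith
  have hκH : 0 < κ ^ H := rpow_pos_of_pos hκ H
  have h2H : 0 < (2 : ℝ) ^ H := rpow_pos_of_pos two_pos H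
  rw [mul_comm H π, hΓ']
  generalize sin (π * H) = σ at hsin ⊢
  have := pi_pos
  field_simp
  ring
end

section
/- Let $H \in (1/2,1)$, $\kappa > 0$ and $\varepsilon > 0$. Then $\int_0^{\infty} \int_{\mathbb{R}} e^{-\kappa s \xi^2}\,(1-\cos(\xi\varepsilon))\, |\xi|^{1-2H}\, d\xi\, ds = -\frac{\Gamma(2-2H)\cos(\pi H)}{\kappa H (2H-1)}\, \varepsilon^{2H}$. -/
open MeasureTheory Real

/-- Tonelli's theorem on `(0, ∞) × (0, ∞)` for Bochner integrals of nonnegative functions; the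
iterated integrals may diverge. -/
lemma integral_Ioi_swap_of_nonneg {f : ℝ → ℝ → ℝ} (hf : Measurable (Function.uncurry f))
    (h0 : ∀ x > 0, ∀ y > 0, 0 ≤ f x y)
    (hy : ∀ x > 0, IntegrableOn (f x) (Set.Ioi 0))
    (hx : ∀ y > 0, IntegrableOn (fun x => f x y) (Set.Ioi 0)) :
    ∫ x in Set.Ioi (0:ℝ), ∫ y in Set.Ioi (0:ℝ), f x y =
      ∫ y in Set.Ioi (0:ℝ), ∫ x in Set.Ioi (0:ℝ), f x y := by
  have hpos : ∀ᵐ x ∂volume.restrict (Set.Ioi (0:ℝ)), 0 < x :=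
    ae_restrict_mem measurableSet_Ioi
  rw [integral_eq_lintegral_of_nonneg_ae, integral_eq_lintegral_of_nonneg_ae]
  · congr 1
    calc _ = ∫⁻ x in Set.Ioi (0:ℝ), ∫⁻ y in Set.Ioi (0:ℝ), ENNReal.ofReal (f x y) := by
          refine lintegral_congr_ae ?_
          filter_upwards [hpos] with x hx'
          refine ofReal_integral_eq_lintegral_ofReal (hy x hx') ?_
          filter_upwards [hpos] with y hy' using h0 x hx' y hy'
      _ = ∫⁻ y in Set.Ioi (0:ℝ), ∫⁻ x in Set.Ioi (0:ℝ), ENNReal.ofReal (f x y) :=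
          lintegral_lintegral_swap (hf.ennreal_ofReal).aemeasurable
      _ = _ := by
          refine lintegral_congr_ae ?_
          filter_upwards [hpos] with y hy'
          refine (ofReal_integral_eq_lintegral_ofReal (hx y hy') ?_).symm
          filter_upwards [hpos] with x hx' using h0 x hx' y hy'
  · filter_upwards [hpos] with y hy'
    exact setIntegral_nonneg measurableSet_Ioi fun x hx' => h0 x hx' y hy'
  · exact hf.stronglyMeasurable.integral_prod_left.aestronglyMeasurable
  · filter_upwards [hpos] with x hx'
    exact setIntegral_nonneg measurableSet_Ioi fun y hy' => h0 x hx' y hy'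
  · exact hf.stronglyMeasurable.integral_prod_right.aestronglyMeasurable

lemma integrableOn_cos_mul_exp_neg_mul_Ioi {t : ℝ} (ht : 0 < t) :
    IntegrableOn (fun x => cos x * exp (-t * x)) (Set.Ioi 0) := by
  refine (exp_neg_integrableOn_Ioi 0 ht).mono' (by fun_prop) (ae_of_all _ fun x => ?_)
  rw [norm_mul, norm_eq_abs, norm_of_nonneg (exp_pos _).le]
  exact mul_le_of_le_one_left (exp_pos _).le (abs_cos_le_one x)

lemma integral_cos_mul_exp_neg_mul_Ioi {t : ℝ} (ht : 0 < t) :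
    ∫ x in Set.Ioi (0:ℝ), cos x * exp (-t * x) = t / (t ^ 2 + 1) := by
  have ha : (-(t : ℂ) + Complex.I).re < 0 := by simpa using ht
  have h := integral_exp_mul_complex_Ioi ha 0
  have hi := integrableOn_exp_mul_complex_Ioi ha 0
  have h2 := congrArg Complex.re h
  have h3 : (∫ x in Set.Ioi (0:ℝ), Complex.exp ((-(t : ℂ) + Complex.I) * x)).re =
      ∫ x in Set.Ioi (0:ℝ), (Complex.exp ((-(t : ℂ) + Complex.I) * x)).re :=
    (integral_re hi).symm
  rw [h3] at h2
  have h4 : ∀ x : ℝ, (Complex.exp ((-(t : ℂ) + Complex.I) * x)).re = cos x * exp (-t * x) := by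
    intro x
    simp [Complex.exp_re, mul_comm]
  simp only [h4] at h2
  rw [h2]
  simp [Complex.div_re, Complex.normSq_apply, pow_two]

lemma integrableOn_one_sub_cos_mul_exp_neg_mul_Ioi {t : ℝ} (ht : 0 < t) :
    IntegrableOn (fun x => (1 - cos x) * exp (-t * x)) (Set.Ioi 0) := by
  simp only [sub_mul, one_mul]
  exact (exp_neg_integrableOn_Ioi 0 ht).sub (integrableOn_cos_mul_exp_neg_mul_Ioi ht)

lemma integral_one_sub_cos_mul_exp_neg_mul_Ioi {t : ℝ} (ht : 0 < t) :
    ∫ x in Set.Ioi (0:ℝ), (1 - cos x) * exp (-t * x) = 1 / (t * (t ^ 2 + 1)) := by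
  simp only [sub_mul, one_mul]
  rw [integral_sub (exp_neg_integrableOn_Ioi 0 ht) (integrableOn_cos_mul_exp_neg_mul_Ioi ht),
    integral_cos_mul_exp_neg_mul_Ioi ht, integral_exp_mul_Ioi (by linarith)]
  have : t ^ 2 + 1 ≠ 0 := by positivity
  simp
  field_simp
  ring

lemma integral_rpow_div_one_add_sq_Ioi {a : ℝ} (h0 : 0 < a) (h2 : a < 2) :
    ∫ t in Set.Ioi (0:ℝ), t ^ (a - 1) / (t ^ 2 + 1) = π / (2 * sin (π * (a / 2))) := by
  have hu : ∀ t > (0:ℝ), ∫ u in Set.Ioi (0:ℝ), t ^ (a - 1) * exp (-(t ^ 2 + 1) * u) =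
      t ^ (a - 1) / (t ^ 2 + 1) := by
    intro t ht
    have : 0 < t ^ 2 + 1 := by positivity
    rw [integral_const_mul, integral_exp_mul_Ioi (by linarith), mul_zero, exp_zero, neg_div_neg_eq,
      mul_one_div]
  have hsplit : ∀ t u : ℝ, t ^ (a - 1) * exp (-(t ^ 2 + 1) * u) =
      exp (-u) * (t ^ (a - 1) * exp (-u * t ^ 2)) := by
    intro t u
    rw [show -(t ^ 2 + 1) * u = -u + -u * t ^ 2 by ring, exp_add]
    ring
  have ht : ∀ u > (0:ℝ), ∫ t in Set.Ioi (0:ℝ), t ^ (a - 1) * exp (-(t ^ 2 + 1) * u) =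
      (1 / 2 * Gamma (a / 2)) * (exp (-u) * u ^ ((1 - a / 2) - 1)) := by
    intro u hu
    have h := integral_rpow_mul_exp_neg_mul_rpow (p := 2) (q := a - 1) (b := u) two_pos
      (by linarith) hu
    simp only [rpow_two] at h
    simp only [hsplit]
    rw [integral_const_mul, h, show -(a - 1 + 1) / 2 = (1 - a / 2) - 1 by ring,
      show (a - 1 + 1) / 2 = a / 2 by ring]
    ring
  rw [← setIntegral_congr_fun measurableSet_Ioi hu, integral_Ioi_swap_of_nonneg,
    setIntegral_congr_fun measurableSet_Ioi ht, integral_const_mul,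
    ← Gamma_eq_integral (by linarith), mul_assoc, Gamma_mul_Gamma_one_sub]
  · rw [div_mul_div_comm, one_mul]
  · simp only [Function.uncurry_def]
    fun_prop
  · intro x hx y _
    positivity
  · intro t _
    exact (exp_neg_integrableOn_Ioi 0 (by positivity)).const_mul _
  · intro u hu
    simp only [hsplit]
    exact (integrableOn_rpow_mul_exp_neg_mul_sq hu (by linarith)).const_mul _

lemma Gamma_mul_integral_one_sub_cos_mul_rpow_Ioi {a : ℝ} (h0 : 0 < a) (h2 : a < 2) :
    Gamma (a + 1) * ∫ x in Set.Ioi (0:ℝ), (1 - cos x) * x ^ (-1 - a) =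
      π / (2 * sin (π * (a / 2))) := by
  have ht : ∀ x > (0:ℝ), ∫ t in Set.Ioi (0:ℝ), (1 - cos x) * (t ^ a * exp (-t * x)) =
      Gamma (a + 1) * ((1 - cos x) * x ^ (-1 - a)) := by
    intro x hx
    have h := integral_rpow_mul_exp_neg_mul_Ioi (a := a + 1) (r := x) (by linarith) hx
    rw [add_sub_cancel_right] at h
    rw [integral_const_mul]
    simp only [show ∀ t, -t * x = -(x * t) by intro t; ring]
    rw [h, one_div, inv_rpow hx.le, ← rpow_neg hx.le, show -(a + 1) = -1 - a by ring]
    ring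
  have hx : ∀ t > (0:ℝ), ∫ x in Set.Ioi (0:ℝ), (1 - cos x) * (t ^ a * exp (-t * x)) =
      t ^ (a - 1) / (t ^ 2 + 1) := by
    intro t ht
    simp only [mul_left_comm _ (t ^ a)]
    rw [integral_const_mul, integral_one_sub_cos_mul_exp_neg_mul_Ioi ht, rpow_sub_one ht.ne']
    field_simp
  rw [← integral_const_mul, ← setIntegral_congr_fun measurableSet_Ioi ht,
    integral_Ioi_swap_of_nonneg, setIntegral_congr_fun measurableSet_Ioi hx,
    integral_rpow_div_one_add_sq_Ioi h0 h2]
  · simp only [Function.uncurry_def]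
    fun_prop
  · intro x _ y hy
    have := cos_le_one x
    have : 0 ≤ 1 - cos x := by linarith
    positivity
  · intro x hx
    refine Integrable.const_mul ?_ _
    have := integrableOn_rpow_mul_exp_neg_mul_rpow (p := 1) (s := a) (b := x) (by linarith)
      one_pos hx
    simp only [rpow_one] at this
    simpa only [show ∀ t, -t * x = -x * t by intro t; ring] using this.integrable
  · intro t ht
    simp only [mul_left_comm _ (t ^ a)]
    exact (integrableOn_one_sub_cos_mul_exp_neg_mul_Ioi ht).const_mul _

lemma integral_one_sub_cos_mul_rpow_Ioi {H : ℝ} (hH : H ∈ Set.Ioo (1/2:ℝ) 1) :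
    ∫ x in Set.Ioi (0:ℝ), (1 - cos x) * x ^ (-1 - 2 * H) =
      -(Gamma (2 - 2 * H) * cos (π * H) / (2 * H * (2 * H - 1))) := by
  obtain ⟨h1, h2⟩ := hH
  have h := Gamma_mul_integral_one_sub_cos_mul_rpow_Ioi (a := 2 * H) (by linarith) (by linarith)
  have hG : 0 < Gamma (2 * H + 1) := Gamma_pos_of_pos (by linarith)
  have hsin : 0 < sin (π * H) :=
    sin_pos_of_pos_of_lt_pi (by have := pi_pos; nlinarith) (by have := pi_pos; nlinarith)
  have hcos : cos (π * H) < 0 :=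
    cos_neg_of_pi_div_two_lt_of_lt (by have := pi_pos; nlinarith) (by have := pi_pos; nlinarith)
  have hrefl := Gamma_mul_Gamma_one_sub (2 * H - 1)
  rw [show 1 - (2 * H - 1) = 2 - 2 * H by ring,
    show π * (2 * H - 1) = 2 * (π * H) - π by ring, sin_sub_pi, sin_two_mul] at hrefl
  have hrec : Gamma (2 * H + 1) = 2 * H * ((2 * H - 1) * Gamma (2 * H - 1)) := by
    rw [Gamma_add_one (by linarith), ← Gamma_add_one (by linarith : 2 * H - 1 ≠ 0),
      sub_add_cancel]
  have hH1 : 2 * H - 1 ≠ 0 := by linarith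
  have hH0 : H ≠ 0 := by linarith
  rw [mul_div_cancel_left₀ _ (two_ne_zero' ℝ)] at h
  apply mul_left_cancel₀ hG.ne'
  rw [h, hrec]
  have : 2 * H * ((2 * H - 1) * Gamma (2 * H - 1)) *
      -(Gamma (2 - 2 * H) * cos (π * H) / (2 * H * (2 * H - 1))) =
      -(Gamma (2 * H - 1) * Gamma (2 - 2 * H)) * cos (π * H) := by
    field_simp
  rw [this, hrefl]
  field_simp [hcos.ne]

theorem spatial_double_integral_smooth (H κ ε : ℝ) (hH : H ∈ Set.Ioo (1/2:ℝ) 1)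
    (hκ : 0 < κ) (hε : 0 < ε) :
    ∫ s in Set.Ioi (0:ℝ), ∫ ξ : ℝ,
        Real.exp (-κ * s * ξ^2) * (1 - Real.cos (ξ * ε)) * |ξ| ^ (1 - 2*H) =
      -(Real.Gamma (2 - 2*H) * Real.cos (π * H) / (κ * H * (2*H - 1))) * ε ^ (2*H) := by
  have hcosle : ∀ x : ℝ, 0 ≤ 1 - cos x := fun x => by linarith [cos_le_one x]
  have heven : ∀ s : ℝ,
      ∫ ξ : ℝ, exp (-κ * s * ξ ^ 2) * (1 - cos (ξ * ε)) * |ξ| ^ (1 - 2 * H) =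
      2 * ∫ ξ in Set.Ioi (0:ℝ), exp (-κ * s * ξ ^ 2) * (1 - cos (ξ * ε)) * ξ ^ (1 - 2 * H) := by
    intro s
    rw [← integral_comp_abs]
    congr 1 with ξ
    have : cos (|ξ| * ε) = cos (ξ * ε) := by
      rw [← cos_abs (ξ * ε), abs_mul, abs_of_pos hε]
    rw [sq_abs, this]
  have hexp : ∀ s ξ : ℝ, exp (-κ * s * ξ ^ 2) * (1 - cos (ξ * ε)) * ξ ^ (1 - 2 * H) =
      ((1 - cos (ξ * ε)) * ξ ^ (1 - 2 * H)) * exp (-(κ * ξ ^ 2) * s) := by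
    intro s ξ
    rw [show -(κ * ξ ^ 2) * s = -κ * s * ξ ^ 2 by ring]
    ring
  have hs : ∀ ξ > (0:ℝ),
      ∫ s in Set.Ioi (0:ℝ), exp (-κ * s * ξ ^ 2) * (1 - cos (ξ * ε)) * ξ ^ (1 - 2 * H) =
      κ⁻¹ * ε ^ (1 + 2 * H) * ((1 - cos (ξ * ε)) * (ξ * ε) ^ (-1 - 2 * H)) := by
    intro ξ hξ
    have : 0 < κ * ξ ^ 2 := by positivity
    simp only [hexp]
    rw [integral_const_mul, integral_exp_mul_Ioi (by linarith), mul_rpow hξ.le hε.le,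
      show 1 - 2 * H = -1 - 2 * H + (2 : ℕ) by push_cast; ring, rpow_add_natCast hξ.ne',
      show -1 - 2 * H = -(1 + 2 * H) by ring, rpow_neg hε.le]
    have : ε ^ (1 + 2 * H) ≠ 0 := (rpow_pos_of_pos hε _).ne'
    simp
    field_simp
  simp only [heven]
  rw [integral_const_mul, integral_Ioi_swap_of_nonneg, setIntegral_congr_fun measurableSet_Ioi hs,
    integral_const_mul,
    integral_comp_mul_right_Ioi (fun x => (1 - cos x) * x ^ (-1 - 2 * H)) 0 hε, zero_mul,
    integral_one_sub_cos_mul_rpow_Ioi hH, rpow_add hε, rpow_one, smul_eq_mul]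
  · have : 2 * H - 1 ≠ 0 := by linarith [hH.1]
    have : H ≠ 0 := by linarith [hH.1]
    field_simp
  · simp only [Function.uncurry_def]
    fun_prop
  · intro s _ ξ hξ
    have := hcosle (ξ * ε)
    positivity
  · intro s hs
    have hi := (integrableOn_rpow_mul_exp_neg_mul_sq (mul_pos hκ hs)
      (by linarith [hH.2] : -1 < 1 - 2 * H)).const_mul 2
    refine hi.mono' (by fun_prop) ?_
    filter_upwards [ae_restrict_mem measurableSet_Ioi] with ξ hξ
    have hξ : 0 < ξ := hξ
    have h0 := hcosle (ξ * ε)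
    have h2 : 1 - cos (ξ * ε) ≤ 2 := by linarith [neg_one_le_cos (ξ * ε)]
    rw [norm_of_nonneg (by positivity), neg_mul κ s]
    calc _ = (1 - cos (ξ * ε)) * (ξ ^ (1 - 2 * H) * exp (-(κ * s) * ξ ^ 2)) := by ring
      _ ≤ _ := by gcongr
  · intro ξ hξ
    simp only [hexp]
    exact (exp_neg_integrableOn_Ioi 0 (by positivity)).const_mul _
end
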